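/- For the square of the path on n ≥ 3 vertices, the star chromatic index is: χ'_star(P_3²) = 3, χ'_star(P_4²) = 4, and χ'_star(P_n²) = 6 for every n ≥ 5. -/

import Mathlib

/-- A star `k`-edge-coloring of `G`: a proper edge-coloring (adjacent edges get
distinct colors) such that no path and no cycle with exactly four edges is
bicolored.  The walks `v₀v₁v₂v₃v₄` with consecutive vertices adjacent and with
`v₀,v₁,v₂,v₃` pairwise distinct and `v₁,v₂,v₃,v₄` pairwise distinct are exactly
the paths (when `v₀ ≠ v₄`) and cycles (when `v₀ = v₄`) with four edges; being
bicolored under a proper coloring means the colors alternate. -/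
def IsStarEdgeColoring {V : Type*} (G : SimpleGraph V) {k : ℕ} (c : Sym2 V → Fin k) : Prop :=
  (∀ ⦃u v w : V⦄, G.Adj u v → G.Adj u w → v ≠ w → c s(u, v) ≠ c s(u, w)) ∧
  (∀ v₀ v₁ v₂ v₃ v₄ : V, G.Adj v₀ v₁ → G.Adj v₁ v₂ → G.Adj v₂ v₃ → G.Adj v₃ v₄ →
    v₀ ≠ v₂ → v₀ ≠ v₃ → v₁ ≠ v₃ → v₁ ≠ v₄ → v₂ ≠ v₄ →
    ¬(c s(v₀, v₁) = c s(v₂, v₃) ∧ c s(v₁, v₂) = c s(v₃, v₄)))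

/-- The star chromatic index of `G`: the least `k` such that `G` admits a
star `k`-edge-coloring. -/
noncomputable def starChromaticIndex {V : Type*} (G : SimpleGraph V) : ℕ :=
  sInf {k : ℕ | ∃ c : Sym2 V → Fin k, IsStarEdgeColoring G c}

/-- The square `Pₙ²` of the path on `n` vertices: vertices `0, …, n-1`, with
`i` adjacent to `j` iff `i ≠ j` and `|i - j| ≤ 2`. -/
def pathSq (n : ℕ) : SimpleGraph (Fin n) :=
  SimpleGraph.fromRel (fun a b => (a : ℕ) < (b : ℕ) ∧ (b : ℕ) ≤ (a : ℕ) + 2)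

namespace IsStarEdgeColoring

variable {V W : Type*} {G : SimpleGraph V} {H : SimpleGraph W} {k l : ℕ}

/-- A star edge-coloring pulls back along a homomorphism that is injective on the vertices of
every path with at most three edges. -/
theorem comap {c : Sym2 W → Fin k} (hc : IsStarEdgeColoring H c) (f : G →g H)
    (hf₂ : ∀ ⦃u v w⦄, G.Adj u v → G.Adj v w → u ≠ w → f u ≠ f w)
    (hf₃ : ∀ ⦃u v w x⦄, G.Adj u v → G.Adj v w → G.Adj w x → u ≠ x → f u ≠ f x) :
    IsStarEdgeColoring G fun e => c (e.map f) := by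
  refine ⟨fun u v w huv huw hvw => ?_, fun v₀ v₁ v₂ v₃ v₄ h₀₁ h₁₂ h₂₃ h₃₄ n₀₂ n₀₃ n₁₃ n₁₄ n₂₄ => ?_⟩
  · exact hc.1 (f.map_adj huv) (f.map_adj huw) (hf₂ huv.symm huw hvw)
  · exact hc.2 _ _ _ _ _ (f.map_adj h₀₁) (f.map_adj h₁₂) (f.map_adj h₂₃) (f.map_adj h₃₄)
      (hf₂ h₀₁ h₁₂ n₀₂) (hf₃ h₀₁ h₁₂ h₂₃ n₀₃) (hf₂ h₁₂ h₂₃ n₁₃) (hf₃ h₁₂ h₂₃ h₃₄ n₁₄)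
      (hf₂ h₂₃ h₃₄ n₂₄)

/-- A star edge-coloring stays one after an injective renaming of the colors. -/
theorem comp_injective {c : Sym2 V → Fin k} (hc : IsStarEdgeColoring G c) {g : Fin k → Fin l}
    (hg : Function.Injective g) : IsStarEdgeColoring G (g ∘ c) :=
  ⟨fun _ _ _ huv huw hvw h => hc.1 huv huw hvw (hg h),
    fun _ _ _ _ _ h₀₁ h₁₂ h₂₃ h₃₄ n₀₂ n₀₃ n₁₃ n₁₄ n₂₄ h =>
      hc.2 _ _ _ _ _ h₀₁ h₁₂ h₂₃ h₃₄ n₀₂ n₀₃ n₁₃ n₁₄ n₂₄ ⟨hg h.1, hg h.2⟩⟩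

end IsStarEdgeColoring

/-- The star chromatic index is `k + 1` as soon as `k + 1` colors suffice and `k` do not. -/
theorem starChromaticIndex_eq_succ {V : Type*} {G : SimpleGraph V} {k : ℕ}
    {c : Sym2 V → Fin (k + 1)} (hc : IsStarEdgeColoring G c)
    (hk : ∀ c : Sym2 V → Fin k, ¬IsStarEdgeColoring G c) : starChromaticIndex G = k + 1 := by
  refine le_antisymm (Nat.sInf_le ⟨c, hc⟩) (le_csInf ⟨k + 1, c, hc⟩ ?_)
  rintro m ⟨d, hd⟩
  by_contra! hm
  exact hk _ (hd.comp_injective (Fin.castLE_injective (Nat.lt_succ_iff.mp hm)))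

/-- A symmetric function of the two endpoints gives a star edge-coloring when it satisfies the
defining conditions; these are grouped so that they can be decided efficiently. -/
theorem isStarEdgeColoring_lift {V : Type*} {G : SimpleGraph V} {k : ℕ} {e : V → V → Fin k}
    (he : ∀ u v, e u v = e v u)
    (h_proper : ∀ u v w, G.Adj u v ∧ G.Adj u w ∧ v ≠ w → e u v ≠ e u w)
    (h_star : ∀ v₀ v₁, G.Adj v₀ v₁ → ∀ v₂, G.Adj v₁ v₂ ∧ v₀ ≠ v₂ →
      ∀ v₃, G.Adj v₂ v₃ ∧ v₀ ≠ v₃ ∧ v₁ ≠ v₃ ∧ e v₀ v₁ = e v₂ v₃ →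
      ∀ v₄, G.Adj v₃ v₄ ∧ v₁ ≠ v₄ ∧ v₂ ≠ v₄ → e v₁ v₂ ≠ e v₃ v₄) :
    IsStarEdgeColoring G (Sym2.lift ⟨e, he⟩) :=
  ⟨fun u v w huv huw hvw => h_proper u v w ⟨huv, huw, hvw⟩,
    fun v₀ v₁ v₂ v₃ v₄ h₀₁ h₁₂ h₂₃ h₃₄ n₀₂ n₀₃ n₁₃ n₁₄ n₂₄ h =>
      h_star v₀ v₁ h₀₁ v₂ ⟨h₁₂, n₀₂⟩ v₃ ⟨h₂₃, n₀₃, n₁₃, h.1⟩ v₄ ⟨h₃₄, n₁₄, n₂₄⟩ h.2⟩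

theorem pathSq_adj {n : ℕ} {u v : Fin n} :
    (pathSq n).Adj u v ↔ u ≠ v ∧ (u : ℕ) ≤ v + 2 ∧ (v : ℕ) ≤ u + 2 := by
  simp only [pathSq, SimpleGraph.fromRel_adj, ne_eq, Fin.ext_iff]
  omega

instance (n : ℕ) : DecidableRel (pathSq n).Adj := fun _ _ => decidable_of_iff' _ pathSq_adj

/-- Three colors suffice for the triangle `P₃²`. -/
theorem exists_isStarEdgeColoring_pathSq_three :
    ∃ c : Sym2 (Fin 3) → Fin 3, IsStarEdgeColoring (pathSq 3) c :=
  ⟨_, isStarEdgeColoring_lift (e := fun u v => u + v) (by decide) (by decide) (by decide)⟩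

/-- Four colors suffice for `P₄²`: the edges `v₁v₃` and `v₂v₄` may share their color. -/
theorem exists_isStarEdgeColoring_pathSq_four :
    ∃ c : Sym2 (Fin 4) → Fin 4, IsStarEdgeColoring (pathSq 4) c :=
  ⟨_, isStarEdgeColoring_lift (e := fun u v : Fin 4 => if (u + v : ℕ) = 1 then 0
    else if (u + v : ℕ) = 3 then 1 else if (u + v : ℕ) = 5 then 2 else 3)
    (by decide) (by decide) (by decide +kernel)⟩

/-- The square of the cycle of length eight. -/
abbrev cycleSqEight : SimpleGraph (Fin 8) := SimpleGraph.circulantGraph {1, 2}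

/-- A star edge-coloring of the square of the cycle of length eight with six colors. -/
def cycleSqEightColor (u v : Fin 8) : Fin 6 :=
  if v - u = 1 then ![0, 2, 3, 5, 0, 1, 3, 4] u
  else if u - v = 1 then ![0, 2, 3, 5, 0, 1, 3, 4] v
  else if v - u = 2 then ![1, 1, 4, 4, 2, 2, 5, 5] u
  else if u - v = 2 then ![1, 1, 4, 4, 2, 2, 5, 5] v
  else 0

theorem cycleSqEightColor_comm : ∀ u v, cycleSqEightColor u v = cycleSqEightColor v u := by
  decide

theorem isStarEdgeColoring_cycleSqEight :
    IsStarEdgeColoring cycleSqEight (Sym2.lift ⟨cycleSqEightColor, cycleSqEightColor_comm⟩) :=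
  isStarEdgeColoring_lift _ (by decide +kernel) (by decide +kernel)

/-- Reduction of the vertices modulo eight, as a homomorphism of graphs. -/
def pathSqToCycleSqEight (n : ℕ) : pathSq n →g cycleSqEight where
  toFun v := Fin.ofNat 8 v
  map_rel' {u v} h := by
    rw [pathSq_adj] at h
    simp only [SimpleGraph.circulantGraph_adj, Set.mem_insert_iff, Set.mem_singleton_iff,
      ne_eq, Fin.ext_iff, Fin.val_sub, Fin.val_ofNat] at h ⊢
    have : ((1 : Fin 8) : ℕ) = 1 := rfl
    have : ((2 : Fin 8) : ℕ) = 2 := rfl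
    omega

/-- Six colors suffice for every `Pₙ²`. -/
theorem exists_isStarEdgeColoring_pathSq (n : ℕ) :
    ∃ c : Sym2 (Fin n) → Fin 6, IsStarEdgeColoring (pathSq n) c := by
  refine ⟨_, isStarEdgeColoring_cycleSqEight.comap (pathSqToCycleSqEight n) ?_ ?_⟩
  · intro u v w huv hvw huw h
    rw [pathSq_adj] at huv hvw
    have := congrArg Fin.val h
    change (u : ℕ) % 8 = (w : ℕ) % 8 at this
    simp only [ne_eq, Fin.ext_iff] at *
    omega
  · intro u v w x huv hvw hwx hux h
    rw [pathSq_adj] at huv hvw hwx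
    have := congrArg Fin.val h
    change (u : ℕ) % 8 = (x : ℕ) % 8 at this
    simp only [ne_eq, Fin.ext_iff] at *
    omega

/-- Two colors do not suffice for `P₃²`. -/
theorem not_isStarEdgeColoring_pathSq_three (c : Sym2 (Fin 3) → Fin 2) :
    ¬IsStarEdgeColoring (pathSq 3) c := by
  intro hc
  have h₁ := @hc.1 0 1 2 (by decide) (by decide) (by decide)
  have h₂ := @hc.1 1 0 2 (by decide) (by decide) (by decide)
  have h₃ := @hc.1 2 0 1 (by decide) (by decide) (by decide)
  rw [Sym2.eq_swap (a := 1) (b := 0)] at h₂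
  rw [Sym2.eq_swap (a := 2) (b := 0), Sym2.eq_swap (a := 2) (b := 1)] at h₃
  omega

/-- Three colors do not suffice for `P₄²`. -/
theorem not_isStarEdgeColoring_pathSq_four (c : Sym2 (Fin 4) → Fin 3) :
    ¬IsStarEdgeColoring (pathSq 4) c := by
  intro hc
  have h₁ := @hc.1 1 0 2 (by decide) (by decide) (by decide)
  have h₂ := @hc.1 1 0 3 (by decide) (by decide) (by decide)
  have h₃ := @hc.1 1 2 3 (by decide) (by decide) (by decide)
  have h₄ := @hc.1 2 0 1 (by decide) (by decide) (by decide)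
  have h₅ := @hc.1 2 0 3 (by decide) (by decide) (by decide)
  have h₆ := @hc.1 2 1 3 (by decide) (by decide) (by decide)
  have h₇ := @hc.1 0 1 2 (by decide) (by decide) (by decide)
  have h₈ := @hc.1 3 1 2 (by decide) (by decide) (by decide)
  have h₉ := hc.2 0 1 3 2 0 (by decide) (by decide) (by decide) (by decide) (by decide)
    (by decide) (by decide) (by decide) (by decide)
  have swap (u v : Fin 4) : c s(u, v) = c s(v, u) := by rw [Sym2.eq_swap]
  rw [swap 1 0] at h₁ h₂
  rw [swap 2 0, swap 2 1] at h₄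
  rw [swap 2 0] at h₅
  rw [swap 2 1] at h₆
  rw [swap 3 1, swap 3 2] at h₈
  rw [swap 3 2, swap 2 0] at h₉
  omega

set_option synthInstance.maxSize 1024 in
/-- Five colors do not suffice for `P₅²`. -/
theorem not_isStarEdgeColoring_pathSq_five (c : Sym2 (Fin 5) → Fin 5) :
    ¬IsStarEdgeColoring (pathSq 5) c := by
  intro hc
  -- The colors of the edges `02, 12, 23, 24, 01, 34, 13` are `a, b, p, q, x, y, z`.
  have key : ∀ a b : Fin 5, a ≠ b → ∀ p, a ≠ p → b ≠ p → ∀ q, a ≠ q → b ≠ q → p ≠ q →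
      ∀ x, x ≠ a → x ≠ b → ∀ y, p ≠ y → q ≠ y → ∀ z, x ≠ z → z ≠ y → b ≠ z → p ≠ z →
      ¬(a = z ∧ b = y) → ¬(a = z ∧ x = y) → ¬(a = z ∧ x = q) → ¬(a = z ∧ x = p) →
      ¬(q = z ∧ p = x) → ¬(q = z ∧ y = x) → ¬(q = z ∧ y = a) → ¬(q = z ∧ y = b) →
      ¬(x = p ∧ b = y) → ¬(x = p ∧ a = y) → ¬(x = q ∧ b = y) → ¬(x = q ∧ a = y) → False := by
    decide +kernel
  have swap (u v : Fin 5) : c s(u, v) = c s(v, u) := by rw [Sym2.eq_swap]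
  have proper (u v w : Fin 5) (h : (pathSq 5).Adj v u ∧ (pathSq 5).Adj v w ∧ u ≠ w) :
      c s(u, v) ≠ c s(v, w) := swap v u ▸ hc.1 h.1 h.2.1 h.2.2
  have star (v₀ v₁ v₂ v₃ v₄ : Fin 5) (h : (pathSq 5).Adj v₀ v₁ ∧ (pathSq 5).Adj v₁ v₂ ∧
      (pathSq 5).Adj v₂ v₃ ∧ (pathSq 5).Adj v₃ v₄ ∧
      v₀ ≠ v₂ ∧ v₀ ≠ v₃ ∧ v₁ ≠ v₃ ∧ v₁ ≠ v₄ ∧ v₂ ≠ v₄) :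
      ¬(c s(v₀, v₁) = c s(v₂, v₃) ∧ c s(v₁, v₂) = c s(v₃, v₄)) := by
    obtain ⟨h₀₁, h₁₂, h₂₃, h₃₄, n₀₂, n₀₃, n₁₃, n₁₄, n₂₄⟩ := h
    exact hc.2 _ _ _ _ _ h₀₁ h₁₂ h₂₃ h₃₄ n₀₂ n₀₃ n₁₃ n₁₄ n₂₄
  apply key (c s(0, 2)) (c s(1, 2)) ?_ (c s(2, 3)) ?_ ?_ (c s(2, 4)) ?_ ?_ ?_ (c s(0, 1)) ?_ ?_
    (c s(3, 4)) ?_ ?_ (c s(1, 3)) ?_ ?_ ?_ ?_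
    (fun h => star 0 2 1 3 4 (by decide) ⟨h.1, swap 2 1 ▸ h.2⟩)
    (fun h => star 2 0 1 3 4 (by decide) ⟨swap 2 0 ▸ h.1, h.2⟩)
    (fun h => star 4 2 0 1 3 (by decide) ⟨swap 4 2 ▸ h.2.symm, swap 2 0 ▸ h.1⟩)
    (fun h => star 3 2 0 1 3 (by decide) ⟨swap 3 2 ▸ h.2.symm, swap 2 0 ▸ h.1⟩)
    (fun h => star 4 2 3 1 0 (by decide) ⟨swap 4 2 ▸ swap 3 1 ▸ h.1, swap 1 0 ▸ h.2⟩)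
    (fun h => star 2 4 3 1 0 (by decide) ⟨swap 3 1 ▸ h.1, swap 4 3 ▸ swap 1 0 ▸ h.2⟩)
    (fun h => star 0 2 4 3 1 (by decide) ⟨swap 4 3 ▸ h.2.symm, swap 3 1 ▸ h.1⟩)
    (fun h => star 1 2 4 3 1 (by decide) ⟨swap 4 3 ▸ h.2.symm, swap 3 1 ▸ h.1⟩)
    (fun h => star 0 1 2 3 4 (by decide) h)
    (fun h => star 1 0 2 3 4 (by decide) ⟨swap 1 0 ▸ h.1, h.2⟩)
    (fun h => star 0 1 2 4 3 (by decide) ⟨h.1, swap 4 3 ▸ h.2⟩)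
    (fun h => star 1 0 2 4 3 (by decide) ⟨swap 1 0 ▸ h.1, swap 4 3 ▸ h.2⟩)
  · exact swap 2 1 ▸ proper 0 2 1 (by decide)
  · exact proper 0 2 3 (by decide)
  · exact proper 1 2 3 (by decide)
  · exact proper 0 2 4 (by decide)
  · exact proper 1 2 4 (by decide)
  · exact swap 3 2 ▸ proper 3 2 4 (by decide)
  · exact swap 1 0 ▸ proper 1 0 2 (by decide)
  · exact proper 0 1 2 (by decide)
  · exact proper 2 3 4 (by decide)
  · exact swap 4 3 ▸ proper 2 4 3 (by decide)
  · exact proper 0 1 3 (by decide)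
  · exact proper 1 3 4 (by decide)
  · exact swap 2 1 ▸ proper 2 1 3 (by decide)
  · exact swap 3 1 ▸ proper 2 3 1 (by decide)

/-- Five colors do not suffice for `Pₙ²` when `5 ≤ n`, since it contains `P₅²`. -/
theorem not_isStarEdgeColoring_pathSq {n : ℕ} (hn : 5 ≤ n) (c : Sym2 (Fin n) → Fin 5) :
    ¬IsStarEdgeColoring (pathSq n) c := by
  intro hc
  let f : pathSq 5 →g pathSq n :=
    { toFun := Fin.castLE hn
      map_rel' := fun {u v} h => by simpa [pathSq_adj] using h }
  have hf : Function.Injective f := Fin.castLE_injective hn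
  exact not_isStarEdgeColoring_pathSq_five _
    (hc.comap f (fun _ _ _ _ _ h => hf.ne h) (fun _ _ _ _ _ _ _ h => hf.ne h))

/-- `χ'_star(P₃²) = 3`, `χ'_star(P₄²) = 4`, and `χ'_star(Pₙ²) = 6` for all `n ≥ 5`. -/
theorem starChromaticIndex_pathSq :
    starChromaticIndex (pathSq 3) = 3 ∧ starChromaticIndex (pathSq 4) = 4 ∧
      ∀ n : ℕ, 5 ≤ n → starChromaticIndex (pathSq n) = 6 := by
  refine ⟨?_, ?_, fun n hn => ?_⟩
  · obtain ⟨c, hc⟩ := exists_isStarEdgeColoring_pathSq_three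
    exact starChromaticIndex_eq_succ hc not_isStarEdgeColoring_pathSq_three
  · obtain ⟨c, hc⟩ := exists_isStarEdgeColoring_pathSq_four
    exact starChromaticIndex_eq_succ hc not_isStarEdgeColoring_pathSq_four
  · obtain ⟨c, hc⟩ := exists_isStarEdgeColoring_pathSq n
    exact starChromaticIndex_eq_succ hc (not_isStarEdgeColoring_pathSq hn)
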